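/- Let G be a finite group, k a field, K an algebraic closure of k, and let M and N be finite-dimensional indecomposable kG-modules. If there exists a nonzero KG-module U that is a direct summand of both K ⊗_k M and K ⊗_k N, then M and N are isomorphic as kG-modules. -/

import Mathlib

open TensorProduct

section Defs

variable {k G : Type} [Field k] [Group G]

/-- A `kG`-linear map between two representations of `G` over `k`:
a `k`-linear map commuting with the `G`-actions. -/
def Equivariant {V W : Type} [AddCommGroup V] [Module k V] [AddCommGroup W] [Module k W]
    (ρV : Representation k G V) (ρW : Representation k G W) (f : V →ₗ[k] W) : Prop :=
  ∀ g : G, f ∘ₗ ρV g = ρW g ∘ₗ f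

/-- `ρU` is (isomorphic to) a direct summand of `ρM`, witnessed by an equivariant
split monomorphism. -/
def IsDirectSummandRep {U M : Type} [AddCommGroup U] [Module k U]
    [AddCommGroup M] [Module k M]
    (ρU : Representation k G U) (ρM : Representation k G M) : Prop :=
  ∃ (i : U →ₗ[k] M) (r : M →ₗ[k] U),
    Equivariant ρU ρM i ∧ Equivariant ρM ρU r ∧ r ∘ₗ i = LinearMap.id

/-- A submodule is a subrepresentation if it is stable under the `G`-action. -/
def IsSubrep {V : Type} [AddCommGroup V] [Module k V] (ρ : Representation k G V)
    (p : Submodule k V) : Prop := ∀ g : G, ∀ x ∈ p, ρ g x ∈ p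

/-- A representation is indecomposable if it is nonzero and not the direct sum of
two nonzero subrepresentations. -/
def IndecomposableRep {V : Type} [AddCommGroup V] [Module k V]
    (ρ : Representation k G V) : Prop :=
  Nontrivial V ∧ ¬ ∃ p q : Submodule k V,
    IsSubrep ρ p ∧ IsSubrep ρ q ∧ IsCompl p q ∧ p ≠ ⊥ ∧ q ≠ ⊥

/-- The base change (extension of scalars) of a representation along a field
extension `k → K`. -/
noncomputable def bcRep (K : Type) [Field K] [Algebra k K] {V : Type} [AddCommGroup V]
    [Module k V] (ρ : Representation k G V) : Representation K G (K ⊗[k] V) :=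
  (Module.End.baseChangeHom k K V).toRingHom.toMonoidHom.comp ρ

end Defs

section EquivariantMaps

variable {k G : Type} [Field k] [Group G]
  {V W X : Type} [AddCommGroup V] [Module k V] [AddCommGroup W] [Module k W]
  [AddCommGroup X] [Module k X]
  {ρV : Representation k G V} {ρW : Representation k G W} {ρX : Representation k G X}

namespace Equivariant

lemma apply {f : V →ₗ[k] W} (hf : Equivariant ρV ρW f) (g : G) (x : V) :
    f (ρV g x) = ρW g (f x) :=
  LinearMap.congr_fun (hf g) x

lemma comp {f : W →ₗ[k] X} {h : V →ₗ[k] W} (hf : Equivariant ρW ρX f)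
    (hh : Equivariant ρV ρW h) : Equivariant ρV ρX (f ∘ₗ h) := fun g => by
  ext x
  simp [hh.apply, hf.apply]

lemma pow {f : V →ₗ[k] V} (hf : Equivariant ρV ρV f) (n : ℕ) : Equivariant ρV ρV (f ^ n) := by
  induction n with
  | zero => intro g; rfl
  | succ n ih => rw [pow_succ]; exact ih.comp hf

lemma isSubrep_ker {f : V →ₗ[k] W} (hf : Equivariant ρV ρW f) :
    IsSubrep ρV (LinearMap.ker f) := fun g x hx => by
  rw [LinearMap.mem_ker] at hx ⊢
  rw [hf.apply, hx, map_zero]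

lemma isSubrep_range {f : V →ₗ[k] W} (hf : Equivariant ρV ρW f) :
    IsSubrep ρW (LinearMap.range f) := by
  rintro g _ ⟨x, rfl⟩
  exact ⟨ρV g x, hf.apply g x⟩

end Equivariant

lemma IndecomposableRep.eq_bot_or_eq_bot (h : IndecomposableRep ρV) {p q : Submodule k V}
    (hp : IsSubrep ρV p) (hq : IsSubrep ρV q) (hpq : IsCompl p q) : p = ⊥ ∨ q = ⊥ := by
  by_contra! hne
  exact h.2 ⟨p, q, hp, hq, hpq, hne.1, hne.2⟩

/-- Fitting's lemma: an equivariant endomorphism of a finite-dimensional indecomposable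
representation is nilpotent or bijective. -/
lemma IndecomposableRep.isNilpotent_or_bijective [FiniteDimensional k V]
    (h : IndecomposableRep ρV) {f : V →ₗ[k] V} (hf : Equivariant ρV ρV f) :
    IsNilpotent f ∨ Function.Bijective f := by
  obtain ⟨n, hn, hpos⟩ := (f.eventually_isCompl_ker_pow_range_pow.and
    (Filter.eventually_gt_atTop 0)).exists
  rcases h.eq_bot_or_eq_bot (hf.pow n).isSubrep_ker (hf.pow n).isSubrep_range hn with h0 | h0
  · right
    have hinj : Function.Injective f := by
      rw [← LinearMap.ker_eq_bot, eq_bot_iff, ← h0]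
      obtain ⟨m, rfl⟩ := Nat.exists_eq_succ_of_ne_zero hpos.ne'
      rw [Nat.succ_eq_add_one, pow_succ]
      exact LinearMap.ker_le_ker_comp f (f ^ m)
    exact ⟨hinj, LinearMap.injective_iff_surjective.mp hinj⟩
  · exact Or.inl ⟨n, LinearMap.range_eq_bot.mp h0⟩

/-- A nonzero representation that splits off an indecomposable one is isomorphic to it. -/
lemma IndecomposableRep.bijective_of_comp_bijective [Nontrivial V] (hW : IndecomposableRep ρW)
    {f : V →ₗ[k] W} {g : W →ₗ[k] V} (hf : Equivariant ρV ρW f) (hg : Equivariant ρW ρV g)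
    (hgf : Function.Bijective (g ∘ₗ f)) : Function.Bijective f := by
  have hinj : Function.Injective f := Function.Injective.of_comp hgf.1
  have hcompl : IsCompl (LinearMap.range f) (LinearMap.ker g) := by
    refine ⟨Submodule.disjoint_def.mpr ?_, codisjoint_iff.mpr (eq_top_iff.mpr fun w _ => ?_)⟩
    · rintro _ ⟨x, rfl⟩ hx
      have hx0 : x = 0 := hgf.1 (by simpa using hx)
      rw [hx0, map_zero]
    · obtain ⟨x, hx⟩ := hgf.2 (g w)
      rw [LinearMap.comp_apply] at hx
      refine Submodule.mem_sup.mpr ⟨f x, ⟨x, rfl⟩, w - f x, ?_, add_sub_cancel _ _⟩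
      rw [LinearMap.mem_ker, map_sub, hx, sub_self]
  refine ⟨hinj, LinearMap.range_eq_top.mp ?_⟩
  rcases hW.eq_bot_or_eq_bot hf.isSubrep_range hg.isSubrep_ker hcompl with h0 | h0
  · obtain ⟨x, hx⟩ := exists_ne (0 : V)
    refine absurd (hinj ?_) hx
    rw [LinearMap.range_eq_bot.mp h0, LinearMap.zero_apply, LinearMap.zero_apply]
  · exact eq_top_of_isCompl_bot (h0 ▸ hcompl)

variable (K : Type) [Field K] [Algebra k K]

@[simp]
lemma bcRep_apply_tmul (ρ : Representation k G V) (g : G) (a : K) (x : V) :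
    bcRep K ρ g (a ⊗ₜ[k] x) = a ⊗ₜ[k] ρ g x := rfl

/-- Every equivariant map between base changes is a linear combination of base changes of
equivariant maps. -/
lemma Equivariant.mem_span_baseChange [FiniteDimensional k V]
    {F : K ⊗[k] V →ₗ[K] K ⊗[k] W} (hF : Equivariant (bcRep K ρV) (bcRep K ρW) F) :
    F ∈ Submodule.span K (LinearMap.baseChange K '' {f : V →ₗ[k] W | Equivariant ρV ρW f}) := by
  classical
  let b := Module.Basis.ofVectorSpace k K
  let c := Module.finBasis k V
  let coeff : K ⊗[k] W ≃ₗ[k] _ →₀ W := TensorProduct.equivFinsuppOfBasisLeft b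
  let φ : V →ₗ[k] _ →₀ W := coeff.toLinearMap ∘ₗ F.restrictScalars k ∘ₗ TensorProduct.mk k K V 1
  have hφ (x : V) : coeff (F (1 ⊗ₜ x)) = φ x := rfl
  have hcoeff (g : G) (z : K ⊗[k] W) (i) : coeff (bcRep K ρW g z) i = ρW g (coeff z i) := by
    induction z with
    | zero => simp
    | tmul a w => simp [coeff]
    | add z z' hz hz' => simp [hz, hz']
  have hequi (i) : Equivariant ρV ρW (Finsupp.lapply i ∘ₗ φ) := fun g => by
    ext x
    have := hF.apply g (1 ⊗ₜ x)
    rw [bcRep_apply_tmul] at this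
    simp only [LinearMap.comp_apply, Finsupp.lapply_apply, ← hφ, this, hcoeff]
  let s := Finset.univ.biUnion fun j => (φ (c j)).support
  have hF_eq : F = ∑ i ∈ s, b i • LinearMap.baseChange K (Finsupp.lapply i ∘ₗ φ) := by
    refine (c.baseChange K).ext fun j => ?_
    have hsub : (φ (c j)).support ⊆ s :=
      Finset.subset_biUnion_of_mem (fun j => (φ (c j)).support) (Finset.mem_univ j)
    have h1 : F (1 ⊗ₜ c j) = (φ (c j)).sum fun i w => b i ⊗ₜ w := by
      rw [← TensorProduct.equivFinsuppOfBasisLeft_symm_apply, ← hφ]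
      exact (coeff.symm_apply_apply _).symm
    rw [Module.Basis.baseChange_apply, h1, Finsupp.sum_of_support_subset _ hsub _ (by simp)]
    simp [LinearMap.sum_apply, TensorProduct.smul_tmul']
  rw [hF_eq]
  exact Submodule.sum_mem _ fun i _ => Submodule.smul_mem _ _
    (Submodule.subset_span ⟨_, hequi i, rfl⟩)

/-- The algebra of equivariant endomorphisms. -/
def equivariantEnd (ρ : Representation k G V) : Subalgebra k (Module.End k V) :=
  Subalgebra.centralizer k (Set.range ρ)

lemma mem_equivariantEnd {f : Module.End k V} :
    f ∈ equivariantEnd ρV ↔ Equivariant ρV ρV f := by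
  simp only [equivariantEnd, Subalgebra.mem_centralizer_iff, Set.forall_mem_range]
  exact forall_congr' fun g => eq_comm

/-- An equivariant endomorphism lies in the Jacobson radical of the endomorphism algebra if it
factors through a representation `W` such that all composites `V → W → V` are nilpotent. -/
lemma comp_mem_jacobson_equivariantEnd
    (h : ∀ (f : V →ₗ[k] W) (g : W →ₗ[k] V), Equivariant ρV ρW f → Equivariant ρW ρV g →
      IsNilpotent (g ∘ₗ f : Module.End k V))
    {f : V →ₗ[k] W} {g : W →ₗ[k] V} (hf : Equivariant ρV ρW f) (hg : Equivariant ρW ρV g) :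
    (⟨g ∘ₗ f, mem_equivariantEnd.mpr (hg.comp hf)⟩ : equivariantEnd ρV) ∈
      Ideal.jacobson (⊥ : Ideal (equivariantEnd ρV)) := by
  refine Ideal.mem_jacobson_iff.mpr fun y => ?_
  set x : equivariantEnd ρV := ⟨g ∘ₗ f, mem_equivariantEnd.mpr (hg.comp hf)⟩
  have hnil : IsNilpotent (y * x) := by
    obtain ⟨n, hn⟩ := h f (y.1 ∘ₗ g) hf ((mem_equivariantEnd.mp y.2).comp hg)
    exact ⟨n, Subtype.ext hn⟩
  obtain ⟨u, hu⟩ := hnil.isUnit_add_one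
  refine ⟨↑u⁻¹, ?_⟩
  have : (↑u⁻¹ : equivariantEnd ρV) * (y * x + 1) = 1 := by rw [← hu, Units.inv_mul]
  rw [Ideal.mem_bot, mul_assoc, ← sub_eq_zero.mpr this, mul_add, mul_one]

/-- Linear combinations of base changes of elements of a nilpotent ideal are nilpotent. -/
lemma isNilpotent_of_mem_span_baseChange {E : Subalgebra k (Module.End k V)} {J : Ideal E}
    (hJ : IsNilpotent J) {e : Module.End K (K ⊗[k] V)}
    (he : e ∈ Submodule.span K
      ((fun x : E => LinearMap.baseChange K (x : Module.End k V)) '' J)) :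
    IsNilpotent e := by
  let S (I : Ideal E) : Submodule K (Module.End K (K ⊗[k] V)) :=
    Submodule.span K ((fun x : E => LinearMap.baseChange K (x : Module.End k V)) '' I)
  have hmul (I I' : Ideal E) : S I * S I' ≤ S (I * I') := by
    rw [Submodule.span_mul_span, Submodule.span_le]
    rintro _ ⟨_, ⟨x, hx, rfl⟩, _, ⟨y, hy, rfl⟩, rfl⟩
    exact Submodule.subset_span ⟨x * y, Ideal.mul_mem_mul hx hy, LinearMap.baseChange_comp _ _⟩
  have hpow (n : ℕ) : e ^ (n + 1) ∈ S (J ^ (n + 1)) := by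
    induction n with
    | zero => rwa [zero_add, pow_one, Submodule.pow_one]
    | succ n ih =>
      rw [pow_succ, Submodule.pow_succ]
      exact hmul _ _ (Submodule.mul_mem_mul ih he)
  obtain ⟨n, hn⟩ := hJ
  refine ⟨n + 1, ?_⟩
  have hzero : J ^ (n + 1) = ⊥ := by
    rw [Submodule.pow_succ, hn]
    exact Submodule.bot_smul _
  simpa [S, hzero] using hpow n

lemma comp_mem_of_mem_span_baseChange {A : Set (V →ₗ[k] W)} {B : Set (W →ₗ[k] X)}
    {S : Submodule K (K ⊗[k] V →ₗ[K] K ⊗[k] X)}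
    (hS : ∀ f ∈ A, ∀ g ∈ B, LinearMap.baseChange K (g ∘ₗ f) ∈ S)
    {F : K ⊗[k] V →ₗ[K] K ⊗[k] W} {F' : K ⊗[k] W →ₗ[K] K ⊗[k] X}
    (hF : F ∈ Submodule.span K (LinearMap.baseChange K '' A))
    (hF' : F' ∈ Submodule.span K (LinearMap.baseChange K '' B)) :
    F' ∘ₗ F ∈ S := by
  induction hF' using Submodule.span_induction with
  | zero => simp
  | add a b _ _ ha hb => rw [LinearMap.add_comp]; exact add_mem ha hb
  | smul t a _ ha => rw [LinearMap.smul_comp]; exact Submodule.smul_mem _ _ ha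
  | mem a ha =>
    obtain ⟨g, hg, rfl⟩ := ha
    induction hF using Submodule.span_induction with
    | zero => simp
    | add a b _ _ ha hb => rw [LinearMap.comp_add]; exact add_mem ha hb
    | smul t a _ ha => rw [LinearMap.comp_smul]; exact Submodule.smul_mem _ _ ha
    | mem a ha =>
      obtain ⟨f, hf, rfl⟩ := ha
      rw [← LinearMap.baseChange_comp]
      exact hS f hf g hg

/-- If all composites `V → W → V` of equivariant maps are nilpotent, then so are all composites
of equivariant maps between the base changes. -/
lemma isNilpotent_comp_of_equivariant_bcRep [FiniteDimensional k V] [FiniteDimensional k W]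
    (h : ∀ (f : V →ₗ[k] W) (g : W →ₗ[k] V), Equivariant ρV ρW f → Equivariant ρW ρV g →
      IsNilpotent (g ∘ₗ f : Module.End k V))
    {F : K ⊗[k] V →ₗ[K] K ⊗[k] W} {F' : K ⊗[k] W →ₗ[K] K ⊗[k] V}
    (hF : Equivariant (bcRep K ρV) (bcRep K ρW) F)
    (hF' : Equivariant (bcRep K ρW) (bcRep K ρV) F') :
    IsNilpotent (F' ∘ₗ F : Module.End K (K ⊗[k] V)) := by
  have : IsArtinianRing (equivariantEnd ρV) := IsArtinianRing.of_finite k _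
  refine isNilpotent_of_mem_span_baseChange K
    (IsArtinianRing.isNilpotent_jacobson_bot (R := equivariantEnd ρV)) ?_
  refine comp_mem_of_mem_span_baseChange K (fun f hf g hg => ?_)
    (hF.mem_span_baseChange K) (hF'.mem_span_baseChange K)
  exact Submodule.subset_span
    ⟨⟨g ∘ₗ f, mem_equivariantEnd.mpr (hg.comp hf)⟩, comp_mem_jacobson_equivariantEnd h hf hg, rfl⟩

end EquivariantMaps

/-- If the base changes to an algebraic closure of two finite-dimensional
indecomposable `kG`-modules share a nonzero direct summand, then the modules are
isomorphic over `k`. -/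
theorem indecomposables_with_common_summand_after_base_change_are_isomorphic
    (k : Type) [Field k] (G : Type) [Group G] [Finite G]
    (K : Type) [Field K] [Algebra k K] [IsAlgClosure k K]
    (M N : Type) [AddCommGroup M] [Module k M] [FiniteDimensional k M]
    [AddCommGroup N] [Module k N] [FiniteDimensional k N]
    (ρM : Representation k G M) (ρN : Representation k G N)
    (hM : IndecomposableRep ρM) (hN : IndecomposableRep ρN)
    (U : Type) [AddCommGroup U] [Module K U] (ρU : Representation K G U)
    (hU : Nontrivial U)
    (hUM : IsDirectSummandRep ρU (bcRep K ρM))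
    (hUN : IsDirectSummandRep ρU (bcRep K ρN)) :
    ∃ e : M ≃ₗ[k] N, Equivariant ρM ρN (e : M →ₗ[k] N) := by
  have := hM.1
  by_cases h : ∀ (f : M →ₗ[k] N) (g : N →ₗ[k] M), Equivariant ρM ρN f → Equivariant ρN ρM g →
      IsNilpotent (g ∘ₗ f : Module.End k M)
  · exfalso
    obtain ⟨i, r, hi, hr, hri⟩ := hUM
    obtain ⟨i', r', hi', hr', hri'⟩ := hUN
    obtain ⟨n, hn⟩ := isNilpotent_comp_of_equivariant_bcRep K h (hi'.comp hr) (hi.comp hr')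
    have hri_apply (u : U) : r (i u) = u := LinearMap.congr_fun hri u
    have hri'_apply (u : U) : r' (i' u) = u := LinearMap.congr_fun hri' u
    have hfix (u : U) : (((i ∘ₗ r') ∘ₗ (i' ∘ₗ r) : Module.End K (K ⊗[k] M)) ^ n) (i u) = i u := by
      refine (Module.End.pow_apply _ _ _).trans (Function.iterate_fixed ?_ n)
      simp [hri_apply, hri'_apply]
    obtain ⟨u, hu⟩ := exists_ne (0 : U)
    apply hu
    rw [← hri_apply u, ← hfix u, hn, LinearMap.zero_apply, map_zero]
  · push Not at h
    obtain ⟨f, g, hf, hg, hgf⟩ := h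
    have hbij := (hM.isNilpotent_or_bijective (hg.comp hf)).resolve_left hgf
    exact ⟨LinearEquiv.ofBijective f (hN.bijective_of_comp_bijective hf hg hbij), hf⟩
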